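/- Let G be a finite simple graph with no two triangles sharing a common edge and no triangle sharing a common edge with a 5-cycle, with no difficult components (λ(G) = 0), and with |E(G)| ≤ 2·(|V(G)| − 2). Then α(G) ≥ (9/34)·|V(G)|; equivalently, the independence ratio |V(G)|/α(G) is at most 4 − 2/9. -/

import Mathlib

namespace Paper

/-- `s` is an independent set in the simple graph `G`. -/
def IsIndepSet {V : Type} (G : SimpleGraph V) (s : Finset V) : Prop :=
  ∀ v ∈ s, ∀ w ∈ s, ¬ G.Adj v w

/-- The independence number `α(G)`: the size of a largest independent set. -/
noncomputable def indepNum {V : Type} (G : SimpleGraph V) : ℕ :=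
  sSup {n | ∃ s : Finset V, IsIndepSet G s ∧ s.card = n}

/-- The number of edges `|E(G)|`. -/
noncomputable def numEdges {V : Type} (G : SimpleGraph V) : ℕ :=
  Nat.card G.edgeSet

/-- The degree of a vertex. -/
noncomputable def deg {V : Type} (G : SimpleGraph V) (v : V) : ℕ :=
  Nat.card (G.neighborSet v)

/-- `G` contains a triangle sharing a common edge with a 4-cycle:
the triangle `u v w` and the 4-cycle `u v x y` share the edge `u v`. -/
def HasTriangleAdjC4 {V : Type} (G : SimpleGraph V) : Prop :=
  ∃ u v w x y : V, G.Adj u v ∧ G.Adj v w ∧ G.Adj w u ∧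
    G.Adj v x ∧ G.Adj x y ∧ G.Adj y u ∧ u ≠ x ∧ v ≠ y

/-- `G` contains two triangles sharing a common edge:
the triangles `u v w` and `u v x` share the edge `u v`. -/
def HasAdjTriangles {V : Type} (G : SimpleGraph V) : Prop :=
  ∃ u v w x : V, G.Adj u v ∧ G.Adj v w ∧ G.Adj w u ∧
    G.Adj v x ∧ G.Adj x u ∧ w ≠ x

/-- `G` contains a triangle sharing a common edge with a 5-cycle:
the triangle `u v w` and the 5-cycle `u v x y z` share the edge `u v`. -/
def HasTriangleAdjC5 {V : Type} (G : SimpleGraph V) : Prop :=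
  ∃ u v w x y z : V, G.Adj u v ∧ G.Adj v w ∧ G.Adj w u ∧
    G.Adj v x ∧ G.Adj x y ∧ G.Adj y z ∧ G.Adj z u ∧
    u ≠ x ∧ u ≠ y ∧ v ≠ y ∧ v ≠ z ∧ x ≠ z

/-- The 2-chain of triangles: two disjoint triangles `{0,1,2}` and `{3,4,5}`
joined by the single edge `{2,3}` (6 vertices, 7 edges). -/
def chainGraph : SimpleGraph (Fin 6) :=
  SimpleGraph.fromRel (fun i j =>
    (i.val, j.val) ∈ [(0,1), (0,2), (1,2), (3,4), (3,5), (4,5), (2,3)])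

/-- A connected component is difficult if it is a triangle or a 2-chain of triangles. -/
def IsDifficult {V : Type} (G : SimpleGraph V) (c : G.ConnectedComponent) : Prop :=
  Nonempty (SimpleGraph.induce c.supp G ≃g (⊤ : SimpleGraph (Fin 3))) ∨
  Nonempty (SimpleGraph.induce c.supp G ≃g chainGraph)

/-- `λ(G)`: the number of difficult components of `G`. -/
noncomputable def lambda {V : Type} (G : SimpleGraph V) : ℕ :=
  Nat.card {c : G.ConnectedComponent // IsDifficult G c}

/-- `Φ(S)`: the number of edges of `G` with exactly one endpoint in `S`. -/
noncomputable def phi {V : Type} (G : SimpleGraph V) (S : Set V) : ℕ :=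
  Nat.card {e : Sym2 V | e ∈ G.edgeSet ∧ ∃ x ∈ S, ∃ y, y ∉ S ∧ e = s(x, y)}

/-- The neighbours of `v` inside `S`. -/
def nbrs {V : Type} (G : SimpleGraph V) [DecidableRel G.Adj] (S : Finset V) (v : V) : Finset V :=
  S.filter (G.Adj v)

/-- The degree sum of the subgraph induced by `S`, i.e. twice its number of edges. -/
def degSum {V : Type} (G : SimpleGraph V) [DecidableRel G.Adj] (S : Finset V) : ℕ :=
  ∑ v ∈ S, (nbrs G S v).card

/-- The vertices `a`, `b`, `c` form a triangle. -/
def IsTriangle {V : Type} (G : SimpleGraph V) (a b c : V) : Prop :=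
  G.Adj a b ∧ G.Adj b c ∧ G.Adj a c

/-- The triangles `a b c` and `d e f` are disjoint and joined by the edge `c d`. -/
def IsChain {V : Type} (G : SimpleGraph V) (a b c d e f : V) : Prop :=
  IsTriangle G a b c ∧ IsTriangle G d e f ∧ G.Adj c d ∧
    (a ≠ d ∧ a ≠ e ∧ a ≠ f) ∧ (b ≠ d ∧ b ≠ e ∧ b ≠ f) ∧ (c ≠ d ∧ c ≠ e ∧ c ≠ f)

/-- `D` spans a difficult component of the subgraph induced by `S`. -/
def IsDifficultPiece {V : Type} [DecidableEq V] (G : SimpleGraph V) (S D : Finset V) : Prop :=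
  D ⊆ S ∧ (∀ x ∈ D, ∀ y ∈ S, G.Adj x y → y ∈ D) ∧
    ((∃ a b c, IsTriangle G a b c ∧ D = {a, b, c}) ∨
      ∃ a b c d e f, IsChain G a b c d e f ∧ D = {a, b, c, d, e, f})

/-- The subgraph induced by `S` satisfies `68 α ≥ 30 n - 6 m - k`. -/
def HasLargeIndep {V : Type} (G : SimpleGraph V) [DecidableRel G.Adj] (S : Finset V) (k : ℕ) :
    Prop :=
  ∃ I ⊆ S, IsIndepSet G I ∧ 30 * S.card ≤ 3 * degSum G S + 68 * I.card + k

section Cycles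

variable {V : Type} {G : SimpleGraph V}

theorem eq_of_triangles (h : ¬ HasAdjTriangles G) {u v w x : V} (huv : G.Adj u v)
    (huw : G.Adj u w) (hvw : G.Adj v w) (hux : G.Adj u x) (hvx : G.Adj v x) : w = x := by
  by_contra hne
  exact h ⟨u, v, w, x, huv, hvw, huw.symm, hvx, hux.symm, hne⟩

theorem no_triangle_c5 (h : ¬ HasTriangleAdjC5 G) {u v w x y z : V} (huv : G.Adj u v)
    (huw : G.Adj u w) (hvw : G.Adj v w) (hvx : G.Adj v x) (hxy : G.Adj x y) (hyz : G.Adj y z)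
    (hzu : G.Adj z u) (h1 : u ≠ x) (h2 : u ≠ y) (h3 : v ≠ y) (h4 : v ≠ z) (h5 : x ≠ z) : False :=
  h ⟨u, v, w, x, y, z, huv, hvw, huw.symm, hvx, hxy, hyz, hzu, h1, h2, h3, h4, h5⟩

theorem no_triangle_c4 (hT : ¬ HasAdjTriangles G) (hC : ¬ HasTriangleAdjC5 G) {u v w x y : V}
    (huv : G.Adj u v) (huw : G.Adj u w) (hvw : G.Adj v w) (hvx : G.Adj v x) (hxy : G.Adj x y)
    (hyu : G.Adj y u) (h1 : u ≠ x) (h2 : v ≠ y) : False := by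
  by_cases hwx : w = x
  · subst hwx
    exact h2 (eq_of_triangles hT huw huv hvw.symm hyu.symm hxy)
  by_cases hwy : w = y
  · subst hwy
    exact h1 (eq_of_triangles hT hvw huv.symm huw.symm hvx hxy.symm)
  exact no_triangle_c5 hC huw huv hvw.symm hvw.symm hvx hxy hyu huv.ne h1 hwx hwy h2

theorem IsChain.nonadj (hT : ¬ HasAdjTriangles G) (hC : ¬ HasTriangleAdjC5 G) {a b c d e f : V}
    (h : IsChain G a b c d e f) : ¬ G.Adj a d ∧ ¬ G.Adj a e ∧ ¬ G.Adj a f ∧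
      ¬ G.Adj b d ∧ ¬ G.Adj b e ∧ ¬ G.Adj b f ∧ ¬ G.Adj c e ∧ ¬ G.Adj c f := by
  obtain ⟨⟨h1, h2, h3⟩, ⟨h4, h5, h6⟩, h7, ⟨h8, h9, h10⟩, ⟨h11, h12, h13⟩, h14, h15, h16⟩ := h
  refine ⟨fun h => ?_, fun h => ?_, fun h => ?_, fun h => ?_, fun h => ?_, fun h => ?_,
    fun h => ?_, fun h => ?_⟩
  · exact h11 (eq_of_triangles hT h3 h1 h2.symm h h7)
  · exact no_triangle_c4 hT hC h3 h1 h2.symm h7 h4 h.symm h8 h15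
  · exact no_triangle_c4 hT hC h3 h1 h2.symm h7 h6 h.symm h8 h16
  · exact h8 (eq_of_triangles hT h2 h1.symm h3.symm h h7)
  · exact no_triangle_c4 hT hC h2 h1.symm h3.symm h7 h4 h.symm h11 h15
  · exact no_triangle_c4 hT hC h2 h1.symm h3.symm h7 h6 h.symm h11 h16
  · exact h16 (eq_of_triangles hT h4 h7.symm h.symm h6 h5)
  · exact h15 (eq_of_triangles hT h6 h7.symm h.symm h4 h5.symm)

/-- Two adjacent triangle vertices outside the closed neighbourhood of `v` cannot both have
neighbours among the neighbours of `v`. -/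
theorem not_both_attached (hT : ¬ HasAdjTriangles G) (hC : ¬ HasTriangleAdjC5 G)
    {p q r p' q' v : V} (ht : IsTriangle G p q r) (hp : G.Adj p p') (hq : G.Adj q q')
    (hp' : G.Adj v p') (hq' : G.Adj v q') (hpv : p ≠ v) (hqv : q ≠ v) (h1 : p ≠ q')
    (h2 : q ≠ p') (h3 : r ≠ p') : False := by
  have hne : p' ≠ q' := by
    rintro rfl
    exact h3 (eq_of_triangles hT ht.1 ht.2.2 ht.2.1 hp hq)
  exact no_triangle_c5 hC ht.1 ht.2.2 ht.2.1 hq hq'.symm hp' hp.symm h1 hpv hqv h2 hne.symm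

end Cycles

section Induced

variable {V : Type} {G : SimpleGraph V}

theorem IsTriangle.card [DecidableEq V] (h : IsTriangle G a b c) :
    ({a, b, c} : Finset V).card = 3 :=
  Finset.card_eq_three.2 ⟨a, b, c, h.1.ne, h.2.2.ne, h.2.1.ne, rfl⟩

theorem IsChain.card {a b c d e f : V} [DecidableEq V] (h : IsChain G a b c d e f) :
    ({a, b, c, d, e, f} : Finset V).card = 6 := by
  obtain ⟨⟨h1, h2, h3⟩, ⟨h4, h5, h6⟩, h7, h8, h9, h10⟩ := h
  have := h1.ne
  have := h2.ne
  have := h3.ne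
  have := h4.ne
  have := h5.ne
  have := h6.ne
  simp [*]

variable [DecidableRel G.Adj]

theorem mem_nbrs {S : Finset V} {v w : V} : w ∈ nbrs G S v ↔ w ∈ S ∧ G.Adj v w := by
  simp [nbrs]

theorem HasLargeIndep.mono {S : Finset V} {k l : ℕ} (h : HasLargeIndep G S k) (hkl : k ≤ l) :
    HasLargeIndep G S l := by
  obtain ⟨I, h1, h2, h3⟩ := h
  exact ⟨I, h1, h2, by omega⟩

theorem le_card_nbrs {S T : Finset V} {v : V} (h : ∀ x ∈ T, x ∈ S ∧ G.Adj v x) :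
    T.card ≤ (nbrs G S v).card :=
  Finset.card_le_card fun x hx => mem_nbrs.2 (h x hx)

theorem card_nbrs_le {S T : Finset V} {v : V} (h : ∀ y ∈ S, G.Adj v y → y ∈ T) :
    (nbrs G S v).card ≤ T.card :=
  Finset.card_le_card fun y hy => h y (mem_nbrs.1 hy).1 (mem_nbrs.1 hy).2

theorem nbrs_eq_of_closed {S D : Finset V} (hD : D ⊆ S)
    (hcl : ∀ x ∈ D, ∀ y ∈ S, G.Adj x y → y ∈ D) {x : V} (hx : x ∈ D) :
    nbrs G S x = nbrs G D x := by
  ext y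
  simp only [mem_nbrs]
  exact ⟨fun h => ⟨hcl x hx y h.1 h.2, h.2⟩, fun h => ⟨hD h.1, h.2⟩⟩

theorem degSum_nbrs_le (hT : ¬ HasAdjTriangles G) {S : Finset V} {v : V} :
    degSum G (nbrs G S v) ≤ (nbrs G S v).card := by
  rw [degSum, Finset.card_eq_sum_ones]
  refine Finset.sum_le_sum fun u hu => Finset.card_le_one.2 fun a ha b hb => ?_
  simp only [mem_nbrs] at hu ha hb
  exact eq_of_triangles hT hu.2 ha.1.2 ha.2 hb.1.2 hb.2

theorem degSum_nbrs_eq_zero {S : Finset V} {v : V}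
    (h : ∀ a ∈ S, ∀ b ∈ S, ¬ IsTriangle G v a b) : degSum G (nbrs G S v) = 0 := by
  refine Finset.sum_eq_zero fun u hu => Finset.card_eq_zero.2 (Finset.eq_empty_of_forall_notMem ?_)
  intro w hw
  simp only [mem_nbrs] at hu hw
  exact h u hu.1 w hw.1.1 ⟨hu.2, hw.2, hw.1.2⟩

variable [DecidableEq V]

theorem degSum_add_degSum {S X : Finset V} (hX : X ⊆ S) :
    degSum G S + degSum G X = degSum G (S \ X) + 2 * ∑ x ∈ X, (nbrs G S x).card := by
  have hcard : ∀ v, (nbrs G S v).card = (nbrs G (S \ X) v).card + (nbrs G X v).card := by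
    intro v
    rw [← Finset.card_union_of_disjoint]
    · congr 1
      ext w
      simp only [Finset.mem_union, mem_nbrs, Finset.mem_sdiff]
      have := @hX w
      tauto
    · rw [Finset.disjoint_left]
      intro w
      simp only [mem_nbrs, Finset.mem_sdiff]
      tauto
  have hswap : ∑ v ∈ S \ X, (nbrs G X v).card = ∑ x ∈ X, (nbrs G (S \ X) x).card := by
    simp only [nbrs, Finset.card_filter]
    rw [Finset.sum_comm]
    simp only [G.adj_comm]
  have hsplit : degSum G S = ∑ v ∈ S \ X, (nbrs G S v).card + ∑ x ∈ X, (nbrs G S x).card :=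
    (Finset.sum_sdiff hX).symm
  rw [hsplit]
  simp only [hcard, Finset.sum_add_distrib, degSum]
  omega

theorem HasLargeIndep.extend {S X J : Finset V} {k l : ℕ} (h : HasLargeIndep G (S \ X) k)
    (hX : X ⊆ S) (hJX : J ⊆ X) (hJ : IsIndepSet G J) (hN : ∀ j ∈ J, ∀ y ∈ S, G.Adj j y → y ∈ X)
    (hle : 30 * X.card + 3 * degSum G X + k ≤
      6 * ∑ x ∈ X, (nbrs G S x).card + 68 * J.card + l) : HasLargeIndep G S l := by
  obtain ⟨I, hIS, hI, hcard⟩ := h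
  refine ⟨I ∪ J, ?_, ?_, ?_⟩
  · exact Finset.union_subset (hIS.trans Finset.sdiff_subset) (hJX.trans hX)
  · intro v hv w hw hvw
    rcases Finset.mem_union.1 hv with hv | hv <;> rcases Finset.mem_union.1 hw with hw | hw
    · exact hI v hv w hw hvw
    · have hv' := Finset.mem_sdiff.1 (hIS hv)
      exact hv'.2 (hN w hw v hv'.1 hvw.symm)
    · have hw' := Finset.mem_sdiff.1 (hIS hw)
      exact hw'.2 (hN v hv w hw'.1 hvw)
    · exact hJ v hv w hw hvw
  · have hdisj : Disjoint I J := by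
      rw [Finset.disjoint_left]
      intro x hx hxJ
      exact (Finset.mem_sdiff.1 (hIS hx)).2 (hJX hxJ)
    rw [Finset.card_union_of_disjoint hdisj]
    have h1 := Finset.card_sdiff_add_card_eq_card hX
    have h2 := degSum_add_degSum (G := G) hX
    omega

/-- Removing a union of components. -/
theorem HasLargeIndep.extend_closed {S D J : Finset V} {k l : ℕ} (h : HasLargeIndep G (S \ D) k)
    (hD : D ⊆ S) (hcl : ∀ x ∈ D, ∀ y ∈ S, G.Adj x y → y ∈ D) (hJD : J ⊆ D) (hJ : IsIndepSet G J)
    (hle : 30 * D.card + k ≤ 3 * degSum G D + 68 * J.card + l) : HasLargeIndep G S l := by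
  refine h.extend hD hJD hJ (fun j hj => hcl j (hJD hj)) ?_
  have : ∑ x ∈ D, (nbrs G S x).card = degSum G D :=
    Finset.sum_congr rfl fun x hx => by rw [nbrs_eq_of_closed hD hcl hx]
  omega

theorem IsTriangle.degSum {a b c : V} (h : IsTriangle G a b c) :
    degSum G {a, b, c} = 6 := by
  obtain ⟨h1, h2, h3⟩ := h
  have := h1.ne
  have := h2.ne
  have := h3.ne
  simp [Paper.degSum, nbrs, Finset.filter_insert, Finset.filter_singleton, *, h1.symm, h2.symm,
    h3.symm]

theorem IsChain.degSum (hT : ¬ HasAdjTriangles G) (hC : ¬ HasTriangleAdjC5 G) {a b c d e f : V}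
    (h : IsChain G a b c d e f) : degSum G {a, b, c, d, e, f} = 14 := by
  obtain ⟨n1, n2, n3, n4, n5, n6, n7, n8⟩ := h.nonadj hT hC
  obtain ⟨⟨h1, h2, h3⟩, ⟨h4, h5, h6⟩, h7, h8, h9, h10⟩ := h
  have := h1.ne
  have := h2.ne
  have := h3.ne
  have := h4.ne
  have := h5.ne
  have := h6.ne
  simp [Paper.degSum, nbrs, Finset.filter_insert, Finset.filter_singleton, *, h1.symm, h2.symm,
    h3.symm, h4.symm, h5.symm, h6.symm, h7.symm,
    mt SimpleGraph.Adj.symm n1, mt SimpleGraph.Adj.symm n2, mt SimpleGraph.Adj.symm n3,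
    mt SimpleGraph.Adj.symm n4, mt SimpleGraph.Adj.symm n5, mt SimpleGraph.Adj.symm n6,
    mt SimpleGraph.Adj.symm n7, mt SimpleGraph.Adj.symm n8]

end Induced

section Pieces

variable {V : Type} {G : SimpleGraph V} [DecidableEq V]

theorem IsDifficultPiece.of_sdiff {S X D : Finset V} (h : IsDifficultPiece G (S \ X) D)
    (hX : ∀ x ∈ D, ∀ y ∈ S, y ∈ X → ¬ G.Adj x y) : IsDifficultPiece G S D := by
  refine ⟨h.1.trans Finset.sdiff_subset, fun x hx y hy hxy => ?_, h.2.2⟩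
  exact h.2.1 x hx y (Finset.mem_sdiff.2 ⟨hy, fun hyX => hX x hx y hy hyX hxy⟩) hxy

theorem IsDifficultPiece.of_sdiff_piece {S C D : Finset V} (hC : IsDifficultPiece G S C)
    (hD : IsDifficultPiece G (S \ C) D) : IsDifficultPiece G S D :=
  hD.of_sdiff fun x hx y _ hyC hxy =>
    have hxS := Finset.mem_sdiff.1 (hD.1 hx)
    hxS.2 (hC.2.1 y hyC x hxS.1 hxy.symm)

/-- A triangle of a difficult component, two of whose vertices have no neighbours outside it. -/
theorem IsDifficultPiece.exists_triangle (hT : ¬ HasAdjTriangles G) (hC : ¬ HasTriangleAdjC5 G)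
    {S D : Finset V} (h : IsDifficultPiece G S D) : ∃ p ∈ S, ∃ q ∈ S, ∃ r ∈ S,
      IsTriangle G p q r ∧ (∀ y ∈ S, G.Adj p y → y = q ∨ y = r) ∧
        ∀ y ∈ S, G.Adj q y → y = p ∨ y = r := by
  obtain ⟨hDS, hcl, ⟨a, b, c, ht, rfl⟩ | ⟨a, b, c, d, e, f, ht, rfl⟩⟩ := h
  · refine ⟨a, hDS (by simp), b, hDS (by simp), c, hDS (by simp), ht, fun y hy h => ?_,
      fun y hy h => ?_⟩
    · have := hcl a (by simp) y hy h
      have := h.ne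
      grind
    · have := hcl b (by simp) y hy h
      have := h.ne
      grind
  · have hn := ht.nonadj hT hC
    refine ⟨a, hDS (by simp), b, hDS (by simp), c, hDS (by simp), ht.1, fun y hy h => ?_,
      fun y hy h => ?_⟩
    · have := hcl a (by simp) y hy h
      have := h.ne
      grind
    · have := hcl b (by simp) y hy h
      have := h.ne
      grind

variable [DecidableRel G.Adj]

theorem HasLargeIndep.of_chain (hT : ¬ HasAdjTriangles G) (hC : ¬ HasTriangleAdjC5 G)
    {S : Finset V} {k : ℕ} {a b c d e f : V} (ht : IsChain G a b c d e f)
    (hDS : {a, b, c, d, e, f} ⊆ S)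
    (hcl : ∀ x ∈ ({a, b, c, d, e, f} : Finset V), ∀ y ∈ S, G.Adj x y →
      y ∈ ({a, b, c, d, e, f} : Finset V))
    (hk : HasLargeIndep G (S \ {a, b, c, d, e, f}) k) : HasLargeIndep G S (k + 2) := by
  have hn := ht.nonadj hT hC
  refine hk.extend_closed (J := {a, e}) hDS hcl (by grind) ?_ ?_
  · have := G.adj_comm a e
    simp [IsIndepSet]
    grind
  · rw [ht.card, ht.degSum hT hC, Finset.card_pair ht.2.2.2.1.2.1]
    omega

theorem IsDifficultPiece.hasLargeIndep (hT : ¬ HasAdjTriangles G) (hC : ¬ HasTriangleAdjC5 G)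
    {S D : Finset V} {k : ℕ} (h : IsDifficultPiece G S D) (hk : HasLargeIndep G (S \ D) k) :
    HasLargeIndep G S (k + 4) := by
  obtain ⟨hDS, hcl, ⟨a, b, c, ht, rfl⟩ | ⟨a, b, c, d, e, f, ht, rfl⟩⟩ := h
  · refine hk.extend_closed (J := {a}) hDS hcl (by simp) (by simp [IsIndepSet]) ?_
    rw [ht.card, ht.degSum]
    simp
    omega
  · exact (hk.of_chain hT hC ht hDS hcl).mono (by omega)

theorem exists_adj_of_three_le {S X : Finset V} {p q r : V} (hp : 3 ≤ (nbrs G S p).card)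
    (h : ∀ y ∈ S \ X, G.Adj p y → y = q ∨ y = r) : ∃ y ∈ X, y ∈ S ∧ G.Adj p y := by
  by_contra! hno
  have hsub : nbrs G S p ⊆ {q, r} := by
    intro y hy
    have hy := mem_nbrs.1 hy
    have := h y (Finset.mem_sdiff.2 ⟨hy.1, fun hX => hno y hX hy.1 hy.2⟩) hy.2
    simpa using this
  have := Finset.card_le_card hsub
  have := Finset.card_le_two (a := q) (b := r)
  omega

/-- Every triangle vertex of `S` has at least three neighbours in `S`. -/
def TriangleDegGeThree (G : SimpleGraph V) [DecidableRel G.Adj] (S : Finset V) : Prop :=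
  ∀ a ∈ S, ∀ b ∈ S, ∀ c ∈ S, IsTriangle G a b c → 3 ≤ (nbrs G S a).card

/-- A difficult component left after deleting `X` has a triangle with two edges to `X`. -/
theorem IsDifficultPiece.exists_attached (hT : ¬ HasAdjTriangles G) (hC : ¬ HasTriangleAdjC5 G)
    {S X D : Finset V} (hdeg : TriangleDegGeThree G S) (h : IsDifficultPiece G (S \ X) D) :
    ∃ p ∈ S \ X, ∃ q ∈ S \ X, ∃ r ∈ S \ X, IsTriangle G p q r ∧
      ∃ p' ∈ X, ∃ q' ∈ X, p' ∈ S ∧ q' ∈ S ∧ G.Adj p p' ∧ G.Adj q q' ∧ p' ≠ q' := by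
  obtain ⟨p, hp, q, hq, r, hr, ht, h1, h2⟩ := h.exists_triangle hT hC
  have hpS := (Finset.mem_sdiff.1 hp).1
  have hqS := (Finset.mem_sdiff.1 hq).1
  have hrS := Finset.mem_sdiff.1 hr
  obtain ⟨p', hp'X, hp'S, hpp⟩ := exists_adj_of_three_le (hdeg p hpS q hqS r hrS.1 ht) h1
  obtain ⟨q', hq'X, hq'S, hqq⟩ := exists_adj_of_three_le
    (hdeg q hqS p hpS r hrS.1 ⟨ht.1.symm, ht.2.2, ht.2.1⟩) h2
  refine ⟨p, hp, q, hq, r, hr, ht, p', hp'X, q', hq'X, hp'S, hq'S, hpp, hqq, ?_⟩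
  rintro rfl
  have := eq_of_triangles hT ht.1 ht.2.2 ht.2.1 hpp hqq
  subst this
  exact hrS.2 hp'X

theorem not_isDifficultPiece_sdiff_singleton (hT : ¬ HasAdjTriangles G)
    (hC : ¬ HasTriangleAdjC5 G) {S D : Finset V} {v : V} (hdeg : TriangleDegGeThree G S) :
    ¬ IsDifficultPiece G (S \ {v}) D := by
  intro h
  obtain ⟨p, -, q, -, r, -, -, p', hp', q', hq', -, -, -, -, hne⟩ := h.exists_attached hT hC hdeg
  exact hne ((Finset.mem_singleton.1 hp').trans (Finset.mem_singleton.1 hq').symm)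

theorem not_isDifficultPiece_sdiff_closedNbrs (hT : ¬ HasAdjTriangles G)
    (hC : ¬ HasTriangleAdjC5 G) {S D : Finset V} {v : V} (hdeg : TriangleDegGeThree G S) :
    ¬ IsDifficultPiece G (S \ insert v (nbrs G S v)) D := by
  intro h
  obtain ⟨p, hp, q, hq, r, hr, ht, p', hp', q', hq', -, -, hpp, hqq, -⟩ :=
    h.exists_attached hT hC hdeg
  simp only [Finset.mem_sdiff, Finset.mem_insert, mem_nbrs, not_or, not_and] at hp hq hr hp' hq'
  have hvp : ¬ G.Adj v p := hp.2.2 hp.1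
  have hvq : ¬ G.Adj v q := hq.2.2 hq.1
  have hp2 : G.Adj v p' := by
    rcases hp' with rfl | h
    · exact absurd hpp.symm hvp
    · exact h.2
  have hq2 : G.Adj v q' := by
    rcases hq' with rfl | h
    · exact absurd hqq.symm hvq
    · exact h.2
  refine not_both_attached hT hC ht hpp hqq hp2 hq2 hp.2.1 hq.2.1 ?_ ?_ ?_
  · rintro rfl
    exact hvp hq2
  · rintro rfl
    exact hvq hp2
  · rintro rfl
    exact hr.2.2 hr.1 hp2

theorem degSum_closedNbrs {S : Finset V} {v : V} :
    degSum G (insert v (nbrs G S v)) = 2 * (nbrs G S v).card + degSum G (nbrs G S v) := by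
  have hv : v ∉ nbrs G S v := by simp [mem_nbrs]
  have h0 : nbrs G (insert v (nbrs G S v)) v = nbrs G S v := by
    ext w
    simp only [mem_nbrs, Finset.mem_insert]
    constructor
    · rintro ⟨rfl | h, h2⟩
      · exact absurd h2 (G.loopless.irrefl _)
      · exact h
    · exact fun h => ⟨Or.inr h, h.2⟩
  have h1 : ∀ u ∈ nbrs G S v, (nbrs G (insert v (nbrs G S v)) u).card =
      1 + (nbrs G (nbrs G S v) u).card := by
    intro u hu
    have huv := (mem_nbrs.1 hu).2.symm
    have : nbrs G (insert v (nbrs G S v)) u = insert v (nbrs G (nbrs G S v) u) := by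
      ext w
      simp only [mem_nbrs, Finset.mem_insert]
      constructor
      · tauto
      · rintro (rfl | h)
        · exact ⟨Or.inl rfl, huv⟩
        · exact ⟨Or.inr h.1, h.2⟩
    rw [this, Finset.card_insert_of_notMem (by simp [mem_nbrs]), add_comm]
  rw [degSum, Finset.sum_insert hv, h0, Finset.sum_congr rfl h1, Finset.sum_add_distrib,
    Finset.sum_const, smul_eq_mul, degSum]
  omega

theorem HasLargeIndep.of_closedNbrs {S : Finset V} {v : V} (hv : v ∈ S)
    (h : HasLargeIndep G (S \ insert v (nbrs G S v)) 0)
    (hle : 30 * (nbrs G S v).card + 3 * degSum G (nbrs G S v) ≤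
      6 * ∑ u ∈ nbrs G S v, (nbrs G S u).card + 38) : HasLargeIndep G S 0 := by
  have hvN : v ∉ nbrs G S v := by simp [mem_nbrs]
  refine h.extend (J := {v}) ?_ (by simp) (by simp [IsIndepSet]) ?_ ?_
  · exact Finset.insert_subset hv (Finset.filter_subset _ _)
  · intro j hj y hy hjy
    rw [Finset.mem_singleton] at hj
    subst hj
    exact Finset.mem_insert_of_mem (mem_nbrs.2 ⟨hy, hjy⟩)
  · rw [degSum_closedNbrs, Finset.card_insert_of_notMem hvN, Finset.sum_insert hvN,
      Finset.card_singleton]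
    omega

end Pieces

section Reductions

variable {V : Type} {G : SimpleGraph V} [DecidableEq V]

theorem IsTriangle.exists_eq_of_mem {a b c u : V} (h : IsTriangle G a b c)
    (hu : u ∈ ({a, b, c} : Finset V)) :
    ∃ x y, IsTriangle G u x y ∧ ({a, b, c} : Finset V) = {u, x, y} := by
  obtain ⟨h1, h2, h3⟩ := h
  simp only [Finset.mem_insert, Finset.mem_singleton] at hu
  rcases hu with rfl | rfl | rfl
  · exact ⟨b, c, ⟨h1, h2, h3⟩, rfl⟩
  · exact ⟨a, c, ⟨h1.symm, h3, h2⟩, by grind⟩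
  · exact ⟨a, b, ⟨h3.symm, h1, h2.symm⟩, by grind⟩

variable [DecidableRel G.Adj]

/-- A triangle with exactly one edge leaving it. -/
theorem HasLargeIndep.of_pendant_triangle (hT : ¬ HasAdjTriangles G) (hC : ¬ HasTriangleAdjC5 G)
    {S : Finset V} {a b c u : V} (hno : ∀ D, ¬ IsDifficultPiece G S D)
    (hIH : ∀ R : Finset V, R ⊂ S → (∀ D, ¬ IsDifficultPiece G R D) → HasLargeIndep G R 0)
    (ht : IsTriangle G a b c) (hS : {a, b, c} ⊆ S) (huS : u ∈ S) (huT : u ∉ ({a, b, c} : Finset V))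
    (hcu : G.Adj c u)
    (hcl : ∀ x ∈ ({a, b, c} : Finset V), ∀ y ∈ S, G.Adj x y → y ∈ ({a, b, c} : Finset V) ∨ y = u) :
    HasLargeIndep G (S \ {a, b, c}) 2 := by
  have hss : S \ {a, b, c} ⊂ S :=
    Finset.sdiff_ssubset hS ⟨a, by simp⟩
  have hmem : ∀ D, IsDifficultPiece G (S \ {a, b, c}) D → u ∈ D := by
    intro D hD
    by_contra huD
    refine hno D (hD.of_sdiff fun x hx y hy hyT hxy => ?_)
    have hx' := Finset.mem_sdiff.1 (hD.1 hx)
    rcases hcl y hyT x hx'.1 hxy.symm with h | rfl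
    · exact hx'.2 h
    · exact huD hx
  by_cases hD : ∃ D, IsDifficultPiece G (S \ {a, b, c}) D
  · obtain ⟨D, hD⟩ := hD
    have huD := hmem D hD
    have hgood : HasLargeIndep G ((S \ {a, b, c}) \ D) 0 := by
      refine hIH _ (Finset.sdiff_subset.trans_ssubset hss) fun D' hD' => ?_
      exact (Finset.mem_sdiff.1 (hD'.1 (hmem D' (hD.of_sdiff_piece hD')))).2 huD
    obtain ⟨hDR, hDcl, ⟨d, e, f, ht', rfl⟩ | ⟨d, e, f, d', e', f', ht', rfl⟩⟩ := hD
    · exfalso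
      obtain ⟨x, y, ht', hxy⟩ := ht'.exists_eq_of_mem huD
      rw [hxy] at hDR hDcl
      have hx := Finset.mem_sdiff.1 (@hDR x (by simp))
      have hy := Finset.mem_sdiff.1 (@hDR y (by simp))
      have hu := Finset.mem_sdiff.1 (@hDR u (by simp))
      refine hno {a, b, c, u, x, y} ⟨?_, ?_, Or.inr ⟨a, b, c, u, x, y, ?_, rfl⟩⟩
      · grind
      · intro z hz w hw hzw
        by_cases hwT : w ∈ ({a, b, c} : Finset V)
        · grind
        by_cases hzT : z ∈ ({a, b, c} : Finset V)
        · rcases hcl z hzT w hw hzw with h | h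
          · grind
          · grind
        · have := hDcl z (by grind) w (Finset.mem_sdiff.2 ⟨hw, hwT⟩) hzw
          grind
      · refine ⟨ht, ht', hcu, ?_⟩
        grind
    · exact hgood.of_chain hT hC ht' hDR hDcl
  · exact (hIH _ hss fun D h => hD ⟨D, h⟩).mono (by omega)

/-- A triangle one of whose vertices has degree two. -/
theorem HasLargeIndep.of_triangle_deg_two (hT : ¬ HasAdjTriangles G) (hC : ¬ HasTriangleAdjC5 G)
    {S : Finset V} {a b c : V} (hno : ∀ D, ¬ IsDifficultPiece G S D)
    (hIH : ∀ R : Finset V, R ⊂ S → ∀ B : Finset V,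
      (∀ D, IsDifficultPiece G R D → ∃ b ∈ B, b ∈ D) → HasLargeIndep G R (4 * B.card))
    (ht : IsTriangle G a b c) (hS : {a, b, c} ⊆ S) (ha : (nbrs G S a).card < 3) :
    HasLargeIndep G S 0 := by
  have haS : a ∈ S := hS (by simp)
  have hbS : b ∈ S := hS (by simp)
  have hcS : c ∈ S := hS (by simp)
  obtain ⟨h1, h2, h3⟩ := id ht
  have hNa : nbrs G S a = {b, c} := by
    refine (Finset.eq_of_subset_of_card_le ?_ ?_).symm
    · intro x hx
      rw [mem_nbrs]
      grind
    · rw [Finset.card_pair h2.ne]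
      omega
  have hss : S \ {a, b, c} ⊂ S :=
    Finset.sdiff_ssubset hS ⟨a, by simp⟩
  set B := (nbrs G S b ∪ nbrs G S c) \ {a, b, c} with hB
  have hout : ∀ x ∈ ({a, b, c} : Finset V), ∀ y ∈ S, G.Adj x y →
      y ∈ ({a, b, c} : Finset V) ∨ y ∈ B := by
    intro x hx y hy hxy
    have hy' : y ∈ nbrs G S x := mem_nbrs.2 ⟨hy, hxy⟩
    grind
  have hdb : (nbrs G S b \ {a, b, c}).card + 2 ≤ (nbrs G S b).card := by
    rw [← Finset.card_pair h3.ne, ← Finset.card_union_of_disjoint]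
    · refine Finset.card_le_card fun x hx => ?_
      have : a ∈ nbrs G S b := mem_nbrs.2 ⟨haS, h1.symm⟩
      have : c ∈ nbrs G S b := mem_nbrs.2 ⟨hcS, h2⟩
      grind
    · rw [Finset.disjoint_left]
      grind
  have hdc : (nbrs G S c \ {a, b, c}).card + 2 ≤ (nbrs G S c).card := by
    rw [← Finset.card_pair h1.ne, ← Finset.card_union_of_disjoint]
    · refine Finset.card_le_card fun x hx => ?_
      have : a ∈ nbrs G S c := mem_nbrs.2 ⟨haS, h3.symm⟩
      have : b ∈ nbrs G S c := mem_nbrs.2 ⟨hbS, h2.symm⟩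
      grind
    · rw [Finset.disjoint_left]
      grind
  have hBcard : B.card ≤ (nbrs G S b \ {a, b, c}).card + (nbrs G S c \ {a, b, c}).card := by
    rw [hB, Finset.union_sdiff_distrib]
    exact Finset.card_union_le _ _
  have hsum : ∑ x ∈ ({a, b, c} : Finset V), (nbrs G S x).card =
      2 + ((nbrs G S b).card + (nbrs G S c).card) := by
    rw [Finset.sum_insert (by simp [h1.ne, h3.ne]), Finset.sum_pair h2.ne, hNa,
      Finset.card_pair h2.ne]
  have hext : ∀ k, HasLargeIndep G (S \ {a, b, c}) k → k + 4 ≤ 6 * B.card →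
      HasLargeIndep G S 0 := by
    intro k hk hkB
    refine hk.extend (J := {a}) hS (by simp) (by simp [IsIndepSet]) ?_ ?_
    · intro j hj y hy hjy
      rw [Finset.mem_singleton] at hj
      subst hj
      have hy' : y ∈ nbrs G S j := mem_nbrs.2 ⟨hy, hjy⟩
      grind
    · rw [hsum, ht.card, ht.degSum, Finset.card_singleton]
      omega
  have hBpos : B.card ≠ 0 := by
    intro h0
    rw [Finset.card_eq_zero] at h0
    refine hno {a, b, c} ⟨hS, fun x hx y hy hxy => ?_, Or.inl ⟨a, b, c, ht, rfl⟩⟩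
    have := hout x hx y hy hxy
    simpa [h0] using this
  by_cases hB1 : B.card = 1
  · obtain ⟨u, hu⟩ := Finset.card_eq_one.1 hB1
    have huB : u ∈ B := by simp [hu]
    have huS : u ∈ S := by
      simp only [hB, Finset.mem_sdiff, Finset.mem_union, mem_nbrs] at huB
      tauto
    have huT : u ∉ ({a, b, c} : Finset V) := (Finset.mem_sdiff.1 huB).2
    have hout' : ∀ x ∈ ({a, b, c} : Finset V), ∀ y ∈ S, G.Adj x y →
        y ∈ ({a, b, c} : Finset V) ∨ y = u := by
      intro x hx y hy hxy
      simpa [hu] using hout x hx y hy hxy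
    have hIH0 : ∀ R : Finset V, R ⊂ S → (∀ D, ¬ IsDifficultPiece G R D) →
        HasLargeIndep G R 0 := fun R hR hRD =>
      hIH R hR ∅ fun D hD => absurd hD (hRD D)
    refine hext 2 ?_ (by omega)
    rcases Finset.mem_union.1 (Finset.mem_sdiff.1 huB).1 with h | h
    · have heq : ({a, b, c} : Finset V) = {a, c, b} := by grind
      rw [heq] at hS hout' huT ⊢
      exact of_pendant_triangle hT hC hno hIH0 ⟨h3, h2.symm, h1⟩ hS huS huT (mem_nbrs.1 h).2 hout'
    · exact of_pendant_triangle hT hC hno hIH0 ht hS huS huT (mem_nbrs.1 h).2 hout'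
  · refine hext (4 * B.card) (hIH _ hss B fun D hD => ?_) (by omega)
    by_contra! hmeet
    refine hno D (hD.of_sdiff fun x hx y hy hyT hxy => ?_)
    have hx' := Finset.mem_sdiff.1 (hD.1 hx)
    rcases hout y hyT x hx'.1 hxy.symm with h | h
    · exact hx'.2 h
    · exact hmeet x h hx

theorem exists_nbrs_eq_of_card_three (hT : ¬ HasAdjTriangles G) {S : Finset V} {v a b : V}
    (hv : (nbrs G S v).card = 3) (ha : a ∈ S) (hb : b ∈ S) (ht : IsTriangle G v a b) :
    ∃ c ∈ S, nbrs G S v = {a, b, c} ∧ G.Adj v c ∧ a ≠ c ∧ b ≠ c ∧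
      ¬ G.Adj a c ∧ ¬ G.Adj b c := by
  obtain ⟨h1, h2, h3⟩ := ht
  have hsub : {a, b} ⊆ nbrs G S v := by
    intro x hx
    rw [mem_nbrs]
    grind
  have hcard := Finset.card_sdiff_add_card_eq_card hsub
  rw [Finset.card_pair h2.ne, hv] at hcard
  obtain ⟨c, hc⟩ := Finset.card_eq_one.1 (show (nbrs G S v \ {a, b}).card = 1 by omega)
  have hcm : c ∈ nbrs G S v \ {a, b} := by simp [hc]
  have hcm' := hcm
  simp only [Finset.mem_sdiff, Finset.mem_insert, Finset.mem_singleton, not_or, mem_nbrs] at hcm'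
  refine ⟨c, hcm'.1.1, ?_, hcm'.1.2, Ne.symm hcm'.2.1, Ne.symm hcm'.2.2, fun h => ?_, fun h => ?_⟩
  · rw [← Finset.sdiff_union_of_subset hsub, hc]
    grind
  · exact hcm'.2.2 (eq_of_triangles hT h1 h3 h2 hcm'.1.2 h).symm
  · exact hcm'.2.1 (eq_of_triangles hT h3 h1 h2.symm hcm'.1.2 h).symm

theorem eq_or_eq_of_triangles_of_card_three (hT : ¬ HasAdjTriangles G) {S : Finset V}
    {p q r c g : V} (hp : (nbrs G S p).card = 3) (hq : q ∈ S) (hr : r ∈ S) (hc : c ∈ S)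
    (hg : g ∈ S) (ht : IsTriangle G p q r) (ht' : IsTriangle G p c g) : c = q ∨ c = r := by
  by_contra! hne
  obtain ⟨h1, h2, h3⟩ := ht
  obtain ⟨h4, h5, h6⟩ := ht'
  have hgq : g ≠ q := by
    rintro rfl
    exact hne.2 (eq_of_triangles hT h1 h4 h5.symm h3 h2)
  have hgr : g ≠ r := by
    rintro rfl
    exact hne.1 (eq_of_triangles hT h3 h4 h5.symm h1 h2.symm)
  have hle : ({q, r, c, g} : Finset V).card ≤ (nbrs G S p).card := le_card_nbrs (by grind)
  have : ({q, r, c, g} : Finset V).card = 4 := by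
    have := h2.ne
    have := h5.ne
    simp [*, hne.1.symm, hne.2.symm, hgq.symm, hgr.symm]
  omega

/-- A sufficient condition for the deletion of `X` to leave no difficult component: the triangles
outside `X` are attached only to `b` and to neighbours of a vertex `w`. -/
theorem not_isDifficultPiece_of_attached (hT : ¬ HasAdjTriangles G) (hC : ¬ HasTriangleAdjC5 G)
    {S X D : Finset V} {b w : V} (hdeg : TriangleDegGeThree G S) (hw : w ∈ X) (hb : b ∈ X)
    (hX : ∀ p ∈ S \ X, ∀ q ∈ S \ X, ∀ r ∈ S \ X, IsTriangle G p q r →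
      ∀ p' ∈ X, p' ∈ S → G.Adj p p' → p' = b ∨ G.Adj w p') :
    ¬ IsDifficultPiece G (S \ X) D := by
  have key : ∀ p ∈ S \ X, ∀ q ∈ S \ X, ∀ r ∈ S \ X, IsTriangle G p q r →
      (∀ y ∈ S \ X, G.Adj p y → y = q ∨ y = r) → (∀ y ∈ S \ X, G.Adj q y → y = p ∨ y = r) →
      G.Adj p b ∨ G.Adj q b := by
    intro p hp q hq r hr ht hp1 hq1
    have ht' : IsTriangle G q p r := ⟨ht.1.symm, ht.2.2, ht.2.1⟩
    have hp' := Finset.mem_sdiff.1 hp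
    have hq' := Finset.mem_sdiff.1 hq
    have hr' := Finset.mem_sdiff.1 hr
    obtain ⟨p', hpX, hpS, hpp⟩ :=
      exists_adj_of_three_le (hdeg p hp'.1 q hq'.1 r hr'.1 ht) hp1
    obtain ⟨q', hqX, hqS, hqq⟩ :=
      exists_adj_of_three_le (hdeg q hq'.1 p hp'.1 r hr'.1 ht') hq1
    rcases hX p hp q hq r hr ht p' hpX hpS hpp with rfl | h1
    · exact Or.inl hpp
    rcases hX q hq p hp r hr ht' q' hqX hqS hqq with rfl | h2
    · exact Or.inr hqq
    have hne : ∀ s t : V, s ∉ X → t ∈ X → s ≠ t := fun s t hs ht h => hs (h ▸ ht)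
    exact (not_both_attached hT hC ht hpp hqq h1 h2 (hne _ _ hp'.2 hw) (hne _ _ hq'.2 hw)
      (hne _ _ hp'.2 hqX) (hne _ _ hq'.2 hpX) (hne _ _ hr'.2 hpX)).elim
  intro hD
  obtain ⟨hDS, hcl, ⟨p, q, r, ht, rfl⟩ | ⟨p, q, r, d, e, f, ht, rfl⟩⟩ := hD
  · have hp : p ∈ S \ X := hDS (by simp)
    have hq : q ∈ S \ X := hDS (by simp)
    have hr : r ∈ S \ X := hDS (by simp)
    have hin : ∀ s ∈ ({p, q, r} : Finset V), ∀ y ∈ S \ X, G.Adj s y →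
        y = p ∨ y = q ∨ y = r := fun s hs y hy h => by
      simpa using hcl s hs y hy h
    have hp1 : ∀ y ∈ S \ X, G.Adj p y → y = q ∨ y = r := fun y hy h =>
      (hin p (by simp) y hy h).resolve_left h.ne'
    have hq1 : ∀ y ∈ S \ X, G.Adj q y → y = r ∨ y = p := fun y hy h => by
      have := hin q (by simp) y hy h
      have := h.ne'
      tauto
    have hr1 : ∀ y ∈ S \ X, G.Adj r y → y = p ∨ y = q := fun y hy h => by
      have := hin r (by simp) y hy h
      have := h.ne'
      tauto
    have hne : ∀ s ∈ S \ X, s ≠ b := fun s hs h => (Finset.mem_sdiff.1 hs).2 (h ▸ hb)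
    obtain ⟨h1, h2, h3⟩ := id ht
    have k1 := key p hp q hq r hr ht hp1 fun y hy h => (hq1 y hy h).symm
    have k2 := key q hq r hr p hp ⟨h2, h3.symm, h1.symm⟩ hq1
      fun y hy h => (hr1 y hy h).symm
    have k3 := key p hp r hr q hq ⟨h3, h2.symm, h1⟩
      (fun y hy h => (hp1 y hy h).symm) hr1
    have n1 : ¬ (G.Adj p b ∧ G.Adj q b) := fun h =>
      hne r hr (eq_of_triangles hT h1 h3 h2 h.1 h.2)
    have n2 : ¬ (G.Adj q b ∧ G.Adj r b) := fun h =>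
      hne p hp (eq_of_triangles hT h2 h1.symm h3.symm h.1 h.2)
    have n3 : ¬ (G.Adj p b ∧ G.Adj r b) := fun h =>
      hne q hq (eq_of_triangles hT h3 h1 h2.symm h.1 h.2)
    tauto
  · have hp : p ∈ S \ X := hDS (by simp)
    have hq : q ∈ S \ X := hDS (by simp)
    have hr : r ∈ S \ X := hDS (by simp)
    have hd : d ∈ S \ X := hDS (by simp)
    have he : e ∈ S \ X := hDS (by simp)
    have hf : f ∈ S \ X := hDS (by simp)
    obtain ⟨m1, m2, m3, m4, m5, m6, m7, m8⟩ := ht.nonadj hT hC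
    have hin : ∀ s ∈ ({p, q, r, d, e, f} : Finset V), ∀ y ∈ S \ X, G.Adj s y →
        y = p ∨ y = q ∨ y = r ∨ y = d ∨ y = e ∨ y = f := fun s hs y hy h => by
      simpa using hcl s hs y hy h
    have hne : ∀ s ∈ S \ X, b ≠ s := fun s hs h => (Finset.mem_sdiff.1 hs).2 (h ▸ hb)
    obtain ⟨⟨h1, h2, h3⟩, ⟨h4, h5, h6⟩, h7, h8, h9, h10⟩ := id ht
    have k1 := key p hp q hq r hr ⟨h1, h2, h3⟩ (fun y hy h => by
      rcases hin p (by simp) y hy h with rfl | rfl | rfl | rfl | rfl | rfl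
      exacts [(h.ne rfl).elim, Or.inl rfl, Or.inr rfl, (m1 h).elim, (m2 h).elim, (m3 h).elim]) (fun y hy h => by
      rcases hin q (by simp) y hy h with rfl | rfl | rfl | rfl | rfl | rfl
      exacts [Or.inl rfl, (h.ne rfl).elim, Or.inr rfl, (m4 h).elim, (m5 h).elim, (m6 h).elim])
    have k2 := key e he f hf d hd ⟨h5, h6.symm, h4.symm⟩ (fun y hy h => by
      rcases hin e (by simp) y hy h with rfl | rfl | rfl | rfl | rfl | rfl
      exacts [(m2 h.symm).elim, (m5 h.symm).elim, (m7 h.symm).elim, Or.inr rfl, (h.ne rfl).elim, Or.inl rfl]) (fun y hy h => by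
      rcases hin f (by simp) y hy h with rfl | rfl | rfl | rfl | rfl | rfl
      exacts [(m3 h.symm).elim, (m6 h.symm).elim, (m8 h.symm).elim, Or.inr rfl, Or.inl rfl, (h.ne rfl).elim])
    rcases k1 with k1 | k1 <;> rcases k2 with k2 | k2
    · exact no_triangle_c5 hC h3 h1 h2.symm h7 h4 k2 k1.symm h8.1 h8.2.1 h10.2.1
        (hne r hr).symm (hne d hd).symm
    · exact no_triangle_c5 hC h3 h1 h2.symm h7 h6 k2 k1.symm h8.1 h8.2.2 h10.2.2
        (hne r hr).symm (hne d hd).symm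
    · exact no_triangle_c5 hC h2 h1.symm h3.symm h7 h4 k2 k1.symm h9.1 h9.2.1 h10.2.1
        (hne r hr).symm (hne d hd).symm
    · exact no_triangle_c5 hC h2 h1.symm h3.symm h7 h6 k2 k1.symm h9.1 h9.2.2 h10.2.2
        (hne r hr).symm (hne d hd).symm

theorem degSum_cubic_le {S : Finset V} {v a b c a' x y : V}
    (hXS : ({v, a, b, c, a', x, y} : Finset V) ⊆ S) (hv : (nbrs G S v).card = 3)
    (ha : (nbrs G S a).card = 3) (ha' : (nbrs G S a').card = 3) (nac : ¬ G.Adj a c)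
    (nbc : ¬ G.Adj b c) (nba : ¬ G.Adj b a') (nca : ¬ G.Adj a' c) (nxv : ¬ G.Adj x v)
    (nxa : ¬ G.Adj x a) (nxb : ¬ G.Adj x b) (nxc : ¬ G.Adj x c) (nyv : ¬ G.Adj y v)
    (nya : ¬ G.Adj y a) (nyb : ¬ G.Adj y b) (nyc : ¬ G.Adj y c) :
    degSum G {v, a, b, c, a', x, y} ≤ 16 := by
  have hle : ∀ w, (nbrs G S w).card = 3 → (nbrs G {v, a, b, c, a', x, y} w).card ≤ 3 :=
    fun w hw => hw ▸ Finset.card_le_card (Finset.filter_subset_filter _ hXS)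
  have hb : (nbrs G {v, a, b, c, a', x, y} b).card ≤ 2 :=
    (card_nbrs_le (T := {v, a}) (by simp [nbc, nba, mt SimpleGraph.Adj.symm nxb, mt SimpleGraph.Adj.symm nyb])).trans
      Finset.card_le_two
  have hc : (nbrs G {v, a, b, c, a', x, y} c).card ≤ 1 :=
    (card_nbrs_le (T := {v}) (by
      simp [mt SimpleGraph.Adj.symm nac, mt SimpleGraph.Adj.symm nbc, mt SimpleGraph.Adj.symm nca, mt SimpleGraph.Adj.symm nxc, mt SimpleGraph.Adj.symm nyc])).trans_eq
      (Finset.card_singleton v)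
  have hx : (nbrs G {v, a, b, c, a', x, y} x).card ≤ 2 :=
    (card_nbrs_le (T := {a', y}) (by simp [nxv, nxa, nxb, nxc])).trans Finset.card_le_two
  have hy : (nbrs G {v, a, b, c, a', x, y} y).card ≤ 2 :=
    (card_nbrs_le (T := {a', x}) (by simp [nyv, nya, nyb, nyc])).trans Finset.card_le_two
  have hins : ∀ (f : V → ℕ) (w : V) (T : Finset V), ∑ u ∈ insert w T, f u ≤ f w + ∑ u ∈ T, f u := by
    intro f w T
    by_cases h : w ∈ T
    · simp [Finset.insert_eq_of_mem h]
    · exact (Finset.sum_insert h).le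
  have hv' := hle v hv
  have ha1 := hle a ha
  have ha2 := hle a' ha'
  unfold degSum
  generalize hf : (fun u => (nbrs G {v, a, b, c, a', x, y} u).card) = f at *
  calc ∑ u ∈ {v, a, b, c, a', x, y}, f u
      ≤ f v + (f a + (f b + (f c + (f a' + (f x + f y))))) := by
        iterate 6 refine (hins _ _ _).trans (Nat.add_le_add_left ?_ _)
        simp
    _ ≤ 16 := by
        subst hf
        dsimp only
        omega

/-- The case of a vertex of degree three in a part of the graph which is cubic and in which every
vertex lies in a triangle. -/
theorem HasLargeIndep.of_cubic (hT : ¬ HasAdjTriangles G) (hC : ¬ HasTriangleAdjC5 G)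
    {S : Finset V} {v : V}
    (hIH : ∀ R : Finset V, R ⊂ S → (∀ D, ¬ IsDifficultPiece G R D) → HasLargeIndep G R 0)
    (hdeg : TriangleDegGeThree G S)
    (hcub : ∀ w ∈ S, (nbrs G S w).card = 3 → (∃ a ∈ S, ∃ b ∈ S, IsTriangle G w a b) ∧
      ∀ u ∈ nbrs G S w, (nbrs G S u).card = 3)
    (hvS : v ∈ S) (hv : (nbrs G S v).card = 3) : HasLargeIndep G S 0 := by
  obtain ⟨⟨a, haS, b, hbS, hvab⟩, hv3⟩ := hcub v hvS hv
  obtain ⟨c, hcS, hNv, hvc, hac, hbc, nac, nbc⟩ := exists_nbrs_eq_of_card_three hT hv haS hbS hvab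
  obtain ⟨hva, hab, hvb⟩ := hvab
  have ha : (nbrs G S a).card = 3 := hv3 a (by simp [hNv])
  have hb : (nbrs G S b).card = 3 := hv3 b (by simp [hNv])
  have hc : (nbrs G S c).card = 3 := hv3 c (by simp [hNv])
  obtain ⟨a', haS', hNa, haa, hva', hba', nva, nba⟩ :=
    exists_nbrs_eq_of_card_three hT ha hvS hbS ⟨hva.symm, hvb, hab⟩
  obtain ⟨-, ha3⟩ := hcub a haS ha
  have ha' : (nbrs G S a').card = 3 := ha3 a' (by simp [hNa])
  obtain ⟨⟨x, hxS, y, hyS, haxy⟩, ha3'⟩ := hcub a' haS' ha'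
  obtain ⟨z, -, hNa', -, hxz, hyz, nxz, nyz⟩ :=
    exists_nbrs_eq_of_card_three hT ha' hxS hyS haxy
  obtain ⟨hax, hxy, hay⟩ := haxy
  have hx3 : (nbrs G S x).card = 3 := ha3' x (by simp [hNa'])
  have hy3 : (nbrs G S y).card = 3 := ha3' y (by simp [hNa'])
  have hnotin : ∀ w ∈ S, G.Adj a w → ¬ G.Adj w a' := by
    intro w hw haw hwa
    have : w ∈ nbrs G S a := mem_nbrs.2 ⟨hw, haw⟩
    rw [hNa] at this
    have := hwa.ne
    grind
  have hza : z = a := by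
    have h : a ∈ nbrs G S a' := mem_nbrs.2 ⟨haS, haa.symm⟩
    rw [hNa'] at h
    simp only [Finset.mem_insert, Finset.mem_singleton] at h
    rcases h with rfl | rfl | rfl
    · exact absurd hay.symm (hnotin y hyS hxy)
    · exact absurd hax.symm (hnotin x hxS hxy.symm)
    · rfl
  subst hza
  have hca' : c ≠ a' := by
    rintro rfl
    exact nac haa
  have nxv : ¬ G.Adj x v := fun h => no_triangle_c4 hT hC hva hvb hab haa hax h hva' hxz.symm
  have nyv : ¬ G.Adj y v := fun h => no_triangle_c4 hT hC hva hvb hab haa hay h hva' hyz.symm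
  have nxb : ¬ G.Adj x b := fun h =>
    no_triangle_c4 hT hC hab.symm hvb.symm hva.symm haa hax h hba' hxz.symm
  have nyb : ¬ G.Adj y b := fun h =>
    no_triangle_c4 hT hC hab.symm hvb.symm hva.symm haa hay h hba' hyz.symm
  have nca : ¬ G.Adj a' c := fun h =>
    no_triangle_c4 hT hC hva hvb hab haa h hvc.symm hva' hac
  have hxv : x ≠ v := by
    rintro rfl
    exact nva hax.symm
  have hyv : y ≠ v := by
    rintro rfl
    exact nva hay.symm
  have nxc : ¬ G.Adj x c := fun h =>
    no_triangle_c5 hC hva hvb hab haa hax h hvc.symm hva' hxv.symm hxz.symm hac hca'.symm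
  have nyc : ¬ G.Adj y c := fun h =>
    no_triangle_c5 hC hva hvb hab haa hay h hvc.symm hva' hyv.symm hyz.symm hac hca'.symm
  have hxb : x ≠ b := by
    rintro rfl
    exact nba hax.symm
  have hyb : y ≠ b := by
    rintro rfl
    exact nba hay.symm
  have hxc : x ≠ c := by
    rintro rfl
    exact nca hax
  have hyc : y ≠ c := by
    rintro rfl
    exact nca hay
  have hXS : ({v, z, b, c, a', x, y} : Finset V) ⊆ S := by
    simp [Finset.insert_subset_iff, *]
  have hcard : ({v, z, b, c, a', x, y} : Finset V).card = 7 := by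
    have := hva.ne
    have := hab.ne
    have := hvb.ne
    have := hvc.ne
    have := haa.ne
    have := hax.ne
    have := hay.ne
    have := hxy.ne
    simp [*, hxv.symm, hyv.symm, hxz.symm, hyz.symm, hxb.symm, hyb.symm, hxc.symm, hyc.symm]
  have hNc : ∃ d ∈ S, ∃ g ∈ S, IsTriangle G c d g ∧ nbrs G S c = {d, g, v} := by
    obtain ⟨⟨d, hdS, g, hgS, ht⟩, -⟩ := hcub c hcS hc
    obtain ⟨w, -, hNc, -, -, -, -, -⟩ := exists_nbrs_eq_of_card_three hT hc hdS hgS ht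
    have hvN : v ∈ nbrs G S c := mem_nbrs.2 ⟨hvS, hvc.symm⟩
    have hvt : ∀ w ∈ S, G.Adj v w → ¬ G.Adj w c := by
      intro w hw hvw hwc
      have : w ∈ nbrs G S v := mem_nbrs.2 ⟨hw, hvw⟩
      simp only [hNv, Finset.mem_insert, Finset.mem_singleton] at this
      rcases this with rfl | rfl | rfl
      · exact nac hwc
      · exact nbc hwc
      · exact hwc.ne rfl
    rw [hNc] at hvN
    simp only [Finset.mem_insert, Finset.mem_singleton] at hvN
    rcases hvN with rfl | rfl | rfl
    · exact absurd ht.2.2.symm (hvt g hgS ht.2.1)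
    · exact absurd ht.1.symm (hvt d hdS ht.2.1.symm)
    · exact ⟨d, hdS, g, hgS, ht, hNc⟩
  obtain ⟨d, hdS, g, hgS, ⟨hcd, hdg, hcg⟩, hNc⟩ := hNc
  have hc3 := (hcub c hcS hc).2
  have hd3 : (nbrs G S d).card = 3 := hc3 d (by simp [hNc])
  have hg3 : (nbrs G S g).card = 3 := hc3 g (by simp [hNc])
  have hnv : ∀ w ∈ S, G.Adj v w → w ∈ ({z, b, c} : Finset V) := fun w hw h => by
    rw [← hNv]
    exact mem_nbrs.2 ⟨hw, h⟩
  have hnz : ∀ w ∈ S, G.Adj z w → w ∈ ({v, b, a'} : Finset V) := fun w hw h => by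
    rw [← hNa]
    exact mem_nbrs.2 ⟨hw, h⟩
  have hna' : ∀ w ∈ S, G.Adj a' w → w ∈ ({x, y, z} : Finset V) := fun w hw h => by
    rw [← hNa']
    exact mem_nbrs.2 ⟨hw, h⟩
  have hnc : ∀ w ∈ S, G.Adj c w → w ∈ ({d, g, v} : Finset V) := fun w hw h => by
    rw [← hNc]
    exact mem_nbrs.2 ⟨hw, h⟩
  have hno : ∀ D, ¬ IsDifficultPiece G (S \ {v, z, b, c, a', x, y}) D := by
    intro D
    refine not_isDifficultPiece_of_attached hT hC hdeg (w := a') (b := b) (by simp) (by simp)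
      fun p hp q hq r hr ht p' hp' hp'S hpp => ?_
    have hpS := (Finset.mem_sdiff.1 hp).1
    have hqS := (Finset.mem_sdiff.1 hq).1
    have hrS := (Finset.mem_sdiff.1 hr).1
    simp only [Finset.mem_sdiff, Finset.mem_insert, Finset.mem_singleton, not_or] at hp hq hr hp'
    obtain ⟨-, pv, pz, pb, pc, pa, px, py⟩ := hp
    have hcqr : ∀ g' ∈ S, (nbrs G S p).card = 3 → IsTriangle G p c g' → False := by
      intro g' hg' hp3 ht'
      rcases eq_or_eq_of_triangles_of_card_three hT hp3 hqS hrS hcS hg' ht ht' with h | h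
      · exact hq.2.2.2.2.1 h.symm
      · exact hr.2.2.2.2.1 h.symm
    rcases hp' with rfl | rfl | rfl | rfl | rfl | rfl | rfl
    · have := hnv p hpS hpp.symm
      simp only [Finset.mem_insert, Finset.mem_singleton] at this
      rcases this with h | h | h
      exacts [(pz h).elim, (pb h).elim, (pc h).elim]
    · have := hnz p hpS hpp.symm
      simp only [Finset.mem_insert, Finset.mem_singleton] at this
      rcases this with h | h | h
      exacts [(pv h).elim, (pb h).elim, (pa h).elim]
    · exact Or.inl rfl
    · have := hnc p hpS hpp.symm
      simp only [Finset.mem_insert, Finset.mem_singleton] at this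
      rcases this with rfl | rfl | rfl
      · exact (hcqr g hgS hd3 ⟨hcd.symm, hcg, hdg⟩).elim
      · exact (hcqr d hdS hg3 ⟨hcg.symm, hcd, hdg.symm⟩).elim
      · exact absurd rfl pv
    · have := hna' p hpS hpp.symm
      simp only [Finset.mem_insert, Finset.mem_singleton] at this
      rcases this with h | h | h
      exacts [(px h).elim, (py h).elim, (pz h).elim]
    · exact Or.inr hax
    · exact Or.inr hay
  have hsum : ∑ u ∈ ({v, z, b, c, a', x, y} : Finset V), (nbrs G S u).card = 21 := by
    rw [Finset.sum_congr rfl (g := fun _ => 3), Finset.sum_const, hcard, smul_eq_mul]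
    intro u hu
    simp only [Finset.mem_insert, Finset.mem_singleton] at hu
    rcases hu with rfl | rfl | rfl | rfl | rfl | rfl | rfl <;> assumption
  have hedges : degSum G {v, z, b, c, a', x, y} ≤ 16 :=
    degSum_cubic_le hXS hv ha ha' nac nbc nba nca nxv nxz nxb nxc nyv nyz nyb nyc
  refine (hIH _ (Finset.sdiff_ssubset hXS ⟨v, by simp⟩) hno).extend (J := {v, a'}) hXS ?_ ?_ ?_ ?_
  · simp [Finset.insert_subset_iff]
  · simp [IsIndepSet, nva, mt SimpleGraph.Adj.symm nva]
  · intro j hj w hw hjw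
    simp only [Finset.mem_insert, Finset.mem_singleton] at hj
    rcases hj with rfl | rfl
    · exact Finset.mem_of_subset (by simp [Finset.insert_subset_iff]) (hnv w hw hjw)
    · exact Finset.mem_of_subset (by simp [Finset.insert_subset_iff]) (hna' w hw hjw)
  · rw [hsum, hcard, Finset.card_pair hva']
    omega

end Reductions

section Main

variable {V : Type} {G : SimpleGraph V} [DecidableEq V] [DecidableRel G.Adj]

theorem HasLargeIndep.of_five_le (hT : ¬ HasAdjTriangles G) (hC : ¬ HasTriangleAdjC5 G)
    {S : Finset V} {v : V}
    (hIH : ∀ R : Finset V, R ⊂ S → (∀ D, ¬ IsDifficultPiece G R D) → HasLargeIndep G R 0)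
    (hdeg : TriangleDegGeThree G S) (hv : v ∈ S) (h5 : 5 ≤ (nbrs G S v).card) :
    HasLargeIndep G S 0 := by
  have hvS : {v} ⊆ S := Finset.singleton_subset_iff.2 hv
  have hno : ∀ D, ¬ IsDifficultPiece G (S \ {v}) D := fun D =>
    not_isDifficultPiece_sdiff_singleton hT hC hdeg
  refine (hIH _ (Finset.sdiff_ssubset hvS ⟨v, by simp⟩) hno).extend (J := ∅) hvS (by simp)
    (by simp [IsIndepSet]) (by simp) ?_
  have : degSum G {v} = 0 := by simp [degSum, nbrs, Finset.filter_singleton]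
  rw [this, Finset.sum_singleton, Finset.card_singleton]
  omega

theorem degSum_le_two {a b c : V} (hab : a ≠ b) (hac : a ≠ c) (hbc : b ≠ c) (nac : ¬ G.Adj a c)
    (nbc : ¬ G.Adj b c) : degSum G {a, b, c} ≤ 2 := by
  have h1 : (nbrs G {a, b, c} a).card ≤ 1 :=
    (card_nbrs_le (T := {b}) (by simp [nac])).trans_eq (Finset.card_singleton b)
  have h2 : (nbrs G {a, b, c} b).card ≤ 1 :=
    (card_nbrs_le (T := {a}) (by simp [nbc])).trans_eq (Finset.card_singleton a)
  have h3 : (nbrs G {a, b, c} c).card ≤ 0 :=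
    card_nbrs_le (T := ∅) (by simp [mt SimpleGraph.Adj.symm nac, mt SimpleGraph.Adj.symm nbc])
  rw [degSum, Finset.sum_insert (by simp [hab, hac]), Finset.sum_pair hbc]
  omega

/-- A graph without difficult components in which all triangle vertices have degree at least
three. -/
theorem HasLargeIndep.of_triangleDegGeThree (hT : ¬ HasAdjTriangles G)
    (hC : ¬ HasTriangleAdjC5 G) {S : Finset V}
    (hIH : ∀ R : Finset V, R ⊂ S → (∀ D, ¬ IsDifficultPiece G R D) → HasLargeIndep G R 0)
    (hdeg : TriangleDegGeThree G S) : HasLargeIndep G S 0 := by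
  rcases S.eq_empty_or_nonempty with rfl | ⟨v₀, hv₀⟩
  · exact ⟨∅, subset_rfl, by simp [IsIndepSet], by simp⟩
  by_contra hS
  have hclosed : ∀ v ∈ S, 6 * ∑ u ∈ nbrs G S v, (nbrs G S u).card + 38 <
      30 * (nbrs G S v).card + 3 * degSum G (nbrs G S v) := by
    intro v hv
    by_contra! hle
    refine hS (HasLargeIndep.of_closedNbrs hv (hIH _ ?_ fun D =>
      not_isDifficultPiece_sdiff_closedNbrs hT hC hdeg) hle)
    exact Finset.sdiff_ssubset (Finset.insert_subset hv (Finset.filter_subset _ _)) ⟨v, by simp⟩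
  have hnbrs : ∀ v, ∀ u ∈ nbrs G S v, u ∈ S := fun v u hu => (mem_nbrs.1 hu).1
  have hsum : ∀ k, (∀ v ∈ S, k ≤ (nbrs G S v).card) → ∀ v,
      (nbrs G S v).card * k ≤ ∑ u ∈ nbrs G S v, (nbrs G S u).card := fun k hk v => by
    simpa using Finset.card_nsmul_le_sum (nbrs G S v) _ k fun u hu => hk u (hnbrs v u hu)
  have htri : ∀ v ∈ S, (nbrs G S v).card < 3 → degSum G (nbrs G S v) = 0 := fun v hv h3 =>
    degSum_nbrs_eq_zero fun a ha b hb ht => absurd (hdeg v hv a ha b hb ht) (by omega)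
  have hlt5 : ∀ v ∈ S, (nbrs G S v).card < 5 := by
    intro v hv
    by_contra! h5
    exact hS (.of_five_le hT hC hIH hdeg hv h5)
  have h2 : ∀ v ∈ S, 2 ≤ (nbrs G S v).card := by
    intro v hv
    have h := hclosed v hv
    have := degSum_nbrs_le hT (S := S) (v := v)
    omega
  have h3 : ∀ v ∈ S, 3 ≤ (nbrs G S v).card := by
    intro v hv
    by_contra! hlt
    have h := hclosed v hv
    have := htri v hv hlt
    have := hsum 2 h2 v
    have := h2 v hv
    omega
  have hcub : ∀ w ∈ S, (nbrs G S w).card = 3 → (∃ a ∈ S, ∃ b ∈ S, IsTriangle G w a b) ∧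
      ∀ u ∈ nbrs G S w, (nbrs G S u).card = 3 := by
    intro w hw hw3
    have h := hclosed w hw
    have hs := hsum 3 h3 w
    have ht : ∃ a ∈ S, ∃ b ∈ S, IsTriangle G w a b := by
      by_contra! ht
      have := degSum_nbrs_eq_zero ht
      omega
    refine ⟨ht, ?_⟩
    obtain ⟨a, ha, b, hb, ht⟩ := ht
    obtain ⟨c, -, hN, -, hac, hbc, nac, nbc⟩ := exists_nbrs_eq_of_card_three hT hw3 ha hb ht
    have hle := degSum_le_two ht.2.1.ne hac hbc nac nbc
    rw [← hN] at hle
    intro u hu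
    by_contra hu3
    have hlt : ∑ _u ∈ nbrs G S w, 3 < ∑ u ∈ nbrs G S w, (nbrs G S u).card :=
      Finset.sum_lt_sum (fun x hx => h3 x (hnbrs w x hx))
        ⟨u, hu, lt_of_le_of_ne (h3 u (hnbrs w u hu)) (Ne.symm hu3)⟩
    rw [Finset.sum_const, smul_eq_mul] at hlt
    omega
  have h4 : ∀ v ∈ S, 4 ≤ (nbrs G S v).card := by
    intro v hv
    by_contra! hlt
    exact hS (.of_cubic hT hC hIH hdeg hcub hv (by have := h3 v hv; omega))
  have h := hclosed v₀ hv₀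
  have := hsum 4 h4 v₀
  have := degSum_nbrs_le hT (S := S) (v := v₀)
  have := h4 v₀ hv₀
  have := hlt5 v₀ hv₀
  omega

theorem hasLargeIndep (hT : ¬ HasAdjTriangles G) (hC : ¬ HasTriangleAdjC5 G) (S : Finset V) :
    ∀ B : Finset V, (∀ D, IsDifficultPiece G S D → ∃ b ∈ B, b ∈ D) →
      HasLargeIndep G S (4 * B.card) := by
  induction S using Finset.strongInduction with
  | H S ih =>
    intro B hB
    by_cases hD : ∃ D, IsDifficultPiece G S D
    · obtain ⟨D, hD⟩ := hD
      obtain ⟨b, hb, hbD⟩ := hB D hD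
      have hss : S \ D ⊂ S := Finset.sdiff_ssubset hD.1 ⟨b, hbD⟩
      have h := ih _ hss (B.erase b) fun D' hD' => by
        obtain ⟨b', hb', hbD'⟩ := hB D' (hD.of_sdiff_piece hD')
        refine ⟨b', Finset.mem_erase.2 ⟨?_, hb'⟩, hbD'⟩
        rintro rfl
        exact (Finset.mem_sdiff.1 (hD'.1 hbD')).2 hbD
      refine (hD.hasLargeIndep hT hC h).mono ?_
      have := Finset.card_erase_add_one hb
      omega
    · push Not at hD
      refine HasLargeIndep.mono ?_ (Nat.zero_le _)
      by_cases hdeg : TriangleDegGeThree G S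
      · exact .of_triangleDegGeThree hT hC
          (fun R hR hno => ih R hR ∅ fun D h => absurd h (hno D)) hdeg
      · unfold TriangleDegGeThree at hdeg
        push Not at hdeg
        obtain ⟨a, ha, b, hb, c, hc, ht, h3⟩ := hdeg
        exact .of_triangle_deg_two hT hC hD (fun R hR => ih R hR) ht
          (by simp [Finset.insert_subset_iff, ha, hb, hc]) h3

end Main

section Components

variable {V : Type} {G : SimpleGraph V}

/-- A connected induced subgraph with no edges leaving it is a connected component. -/
theorem exists_component_iso {W : Type} {H : SimpleGraph W} (φ : H ↪g G)
    (hcl : ∀ w y, G.Adj (φ w) y → ∃ w', φ w' = y) (hH : H.Connected) :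
    ∃ c : G.ConnectedComponent, Nonempty (SimpleGraph.induce c.supp G ≃g H) := by
  obtain ⟨w₀⟩ := hH.nonempty
  have hreach : ∀ x y, G.Reachable x y → (∃ w, φ w = x) → ∃ w, φ w = y := by
    rintro x y ⟨p⟩
    induction p with
    | nil => exact id
    | cons h _ ih =>
      rintro ⟨w, rfl⟩
      exact ih (hcl w _ h)
  refine ⟨G.connectedComponentMk (φ w₀), ⟨?_⟩⟩
  have hmem : ∀ w, φ w ∈ (G.connectedComponentMk (φ w₀)).supp := fun w => by
    rw [SimpleGraph.ConnectedComponent.mem_supp_iff, SimpleGraph.ConnectedComponent.eq]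
    exact (hH.preconnected w w₀).map φ.toHom
  refine SimpleGraph.Iso.symm ⟨Equiv.ofBijective (fun w => ⟨φ w, hmem w⟩) ⟨?_, ?_⟩, ?_⟩
  · intro w w' h
    exact φ.injective (Subtype.ext_iff.1 h)
  · rintro ⟨y, hy⟩
    rw [SimpleGraph.ConnectedComponent.mem_supp_iff, SimpleGraph.ConnectedComponent.eq] at hy
    obtain ⟨w, rfl⟩ := hreach _ _ hy.symm ⟨w₀, rfl⟩
    exact ⟨w, rfl⟩
  · intro w w'
    exact φ.map_adj_iff

theorem chainGraph_adj (i j : Fin 6) : chainGraph.Adj i j ↔ i ≠ j ∧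
    ((i.val, j.val) ∈ [(0,1), (0,2), (1,2), (3,4), (3,5), (4,5), (2,3)] ∨
      (j.val, i.val) ∈ [(0,1), (0,2), (1,2), (3,4), (3,5), (4,5), (2,3)]) :=
  Iff.rfl

theorem connected_chainGraph : chainGraph.Connected := by
  have h : ∀ i j : Fin 6, i ≠ j ∧
    ((i.val, j.val) ∈ [(0,1), (0,2), (1,2), (3,4), (3,5), (4,5), (2,3)] ∨
      (j.val, i.val) ∈ [(0,1), (0,2), (1,2), (3,4), (3,5), (4,5), (2,3)]) →
      chainGraph.Reachable i j := fun i j hij => ((chainGraph_adj i j).2 hij).reachable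
  have h2 : ∀ i, chainGraph.Reachable i 2 := by
    have h3 : chainGraph.Reachable 3 2 := h 3 2 (by decide)
    intro i
    fin_cases i
    · exact h 0 2 (by decide)
    · exact h 1 2 (by decide)
    · rfl
    · exact h3
    · exact (h 4 3 (by decide)).trans h3
    · exact (h 5 3 (by decide)).trans h3
  exact { preconnected := fun i j => (h2 i).trans (h2 j).symm }

theorem IsDifficultPiece.exists_isDifficult [DecidableEq V] [Fintype V]
    (hT : ¬ HasAdjTriangles G) (hC : ¬ HasTriangleAdjC5 G) {D : Finset V}
    (h : IsDifficultPiece G Finset.univ D) : ∃ c : G.ConnectedComponent, IsDifficult G c := by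
  obtain ⟨-, hcl, ⟨a, b, c, ht, rfl⟩ | ⟨a, b, c, d, e, f, ht, rfl⟩⟩ := h
  · obtain ⟨h1, h2, h3⟩ := ht
    have hadj : ∀ i j : Fin 3, G.Adj (![a, b, c] i) (![a, b, c] j) ↔ i ≠ j := by
      intro i j
      fin_cases i <;> fin_cases j <;> simp [h1, h2, h3, h1.symm, h2.symm, h3.symm]
    let φ : (⊤ : SimpleGraph (Fin 3)) ↪g G :=
      { toFun := ![a, b, c]
        inj' := fun i j hij => by
          by_contra hne
          exact ((hadj i j).2 hne).ne hij
        map_rel_iff' := fun {i j} => hadj i j }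
    have hφ : ∀ w y, G.Adj (φ w) y → ∃ w', φ w' = y := by
      intro w y hwy
      have hw : φ w ∈ ({a, b, c} : Finset V) := by
        change ![a, b, c] w ∈ _
        fin_cases w <;> simp
      have := hcl _ hw y (Finset.mem_univ y) hwy
      simp only [Finset.mem_insert, Finset.mem_singleton] at this
      rcases this with rfl | rfl | rfl
      exacts [⟨0, rfl⟩, ⟨1, rfl⟩, ⟨2, rfl⟩]
    obtain ⟨C, hC⟩ := exists_component_iso φ hφ (by simp)
    exact ⟨C, Or.inl hC⟩
  · obtain ⟨m1, m2, m3, m4, m5, m6, m7, m8⟩ := ht.nonadj hT hC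
    obtain ⟨⟨h1, h2, h3⟩, ⟨h4, h5, h6⟩, h7, ⟨h8, h9, h10⟩, ⟨h11, h12, h13⟩, h14, h15, h16⟩ := ht
    have hadj : ∀ i j : Fin 6, G.Adj (![a, b, c, d, e, f] i) (![a, b, c, d, e, f] j) ↔
        chainGraph.Adj i j := by
      intro i j
      rw [chainGraph_adj]
      fin_cases i <;> fin_cases j <;> simp [h1, h2, h3, h1.symm, h2.symm, h3.symm, h4, h5, h6,
        h4.symm, h5.symm, h6.symm, h7, h7.symm, m1, m2, m3, m4, m5, m6, m7, m8,
        G.adj_comm d, G.adj_comm e, G.adj_comm f]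
    have hinj : Function.Injective ![a, b, c, d, e, f] := by
      have := h1.ne
      have := h2.ne
      have := h3.ne
      have := h4.ne
      have := h5.ne
      have := h6.ne
      intro i j
      fin_cases i <;> fin_cases j <;> simp [*, eq_comm]
    let φ : chainGraph ↪g G :=
      { toFun := ![a, b, c, d, e, f]
        inj' := hinj
        map_rel_iff' := fun {i j} => hadj i j }
    have hφ : ∀ w y, G.Adj (φ w) y → ∃ w', φ w' = y := by
      intro w y hwy
      have hw : φ w ∈ ({a, b, c, d, e, f} : Finset V) := by
        change ![a, b, c, d, e, f] w ∈ _
        fin_cases w <;> simp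
      have := hcl _ hw y (Finset.mem_univ y) hwy
      simp only [Finset.mem_insert, Finset.mem_singleton] at this
      rcases this with rfl | rfl | rfl | rfl | rfl | rfl
      exacts [⟨0, rfl⟩, ⟨1, rfl⟩, ⟨2, rfl⟩, ⟨3, rfl⟩, ⟨4, rfl⟩, ⟨5, rfl⟩]
    obtain ⟨C, hC⟩ := exists_component_iso φ hφ connected_chainGraph
    exact ⟨C, Or.inr hC⟩

end Components

theorem card_le_indepNum {V : Type} [Fintype V] {G : SimpleGraph V} {I : Finset V}
    (hI : IsIndepSet G I) : I.card ≤ indepNum G :=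
  le_csSup ⟨Fintype.card V, by rintro _ ⟨s, -, rfl⟩; exact s.card_le_univ⟩ ⟨I, hI, rfl⟩

theorem degSum_univ {V : Type} [Fintype V] (G : SimpleGraph V) [DecidableRel G.Adj] :
    degSum G Finset.univ = 2 * numEdges G := by
  rw [numEdges, Nat.card_eq_fintype_card, ← SimpleGraph.edgeFinset_card,
    ← SimpleGraph.sum_degrees_eq_twice_card_edges]
  refine Finset.sum_congr rfl fun v _ => ?_
  rw [nbrs, ← SimpleGraph.card_neighborFinset_eq_degree, SimpleGraph.neighborFinset_eq_filter]

/-- Independence ratio at most 4 - 2/9 for graphs with no adjacent triangles,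
no triangle adjacent to a 5-cycle, no difficult components, and |E| ≤ 2(|V| - 2). -/
theorem indep_ratio_novosibirsk
    {V : Type} [Fintype V] (G : SimpleGraph V)
    (hG1 : ¬ HasAdjTriangles G) (hG2 : ¬ HasTriangleAdjC5 G)
    (hlam : lambda G = 0)
    (hE : (numEdges G : ℝ) ≤ 2 * ((Nat.card V : ℝ) - 2)) :
    (indepNum G : ℝ) ≥ (9 / 34) * Nat.card V := by
  classical
  have hno : ∀ D, ¬ IsDifficultPiece G Finset.univ D := by
    intro D hD
    obtain ⟨c, hc⟩ := hD.exists_isDifficult hG1 hG2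
    have hempty : IsEmpty {c : G.ConnectedComponent // IsDifficult G c} :=
      (Nat.card_eq_zero.1 hlam).resolve_right (not_infinite_iff_finite.2 inferInstance)
    exact hempty.false ⟨c, hc⟩
  obtain ⟨I, -, hI, hcard⟩ := hasLargeIndep hG1 hG2 Finset.univ ∅ fun D hD => absurd hD (hno D)
  rw [degSum_univ, Finset.card_univ, ← Nat.card_eq_fintype_card, Finset.card_empty] at hcard
  have hα := card_le_indepNum hI
  have h1 : (30 : ℝ) * Nat.card V ≤ 6 * numEdges G + 68 * indepNum G := by
    exact_mod_cast (by omega : 30 * Nat.card V ≤ 6 * numEdges G + 68 * indepNum G)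
  linarith

end Paper
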